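/- arXiv:2402.08830 — 2 statements merged into one kernel-verified Lean document; each statement's English description precedes it below -/
import Mathlib

section
/- Let G = (V,E) be an unweighted undirected graph (self-loops allowed) with |V| > 1. The following are equivalent: (i) G is connected; (ii) G admits a 2-realization; (iii) G admits infinitely many 2-realizations. Moreover, when these conditions hold, for any two (not necessarily distinct) vertices u and v of G there exists a 2-realization of G whose first element is u and whose last element is v. -/
/-- The sequence (di)graph of `x` with window size `w` has an arc `(u,v)` exactly when
there are positions `k < k' < k + w` with `x_k = u` and `x_{k'} = v`. -/
def seqArc {V : Type*} (w : ℕ) (x : List V) (u v : V) : Prop :=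
  ∃ k k' : ℕ, k < k' ∧ k' < k + w ∧ x[k]? = some u ∧ x[k']? = some v

/-- Edge of the (undirected) sequence graph of `x` with window size `w`. -/
def seqEdge {V : Type*} (w : ℕ) (x : List V) (u v : V) : Prop :=
  seqArc w x u v ∨ seqArc w x v u

/-- `x` is a `w`-realization of the undirected graph on vertex set `V` (self-loops allowed)
with adjacency relation `Adj`: `x` is nonempty, every vertex occurs in `x`, and the edges of
the sequence graph of `x` with window size `w` are exactly those of the graph. -/
def IsRealizationG {V : Type*} (w : ℕ) (Adj : V → V → Prop) (x : List V) : Prop :=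
  x ≠ [] ∧ (∀ v : V, v ∈ x) ∧ ∀ u v : V, Adj u v ↔ seqEdge w x u v

theorem seqArc_two {V : Type*} (x : List V) (u v : V) :
    seqArc 2 x u v ↔ ∃ k : ℕ, x[k]? = some u ∧ x[k+1]? = some v := by
  constructor
  · rintro ⟨k, k', h1, h2, h3, h4⟩
    obtain rfl : k' = k + 1 := by omega
    exact ⟨k, h3, h4⟩
  · rintro ⟨k, h3, h4⟩
    exact ⟨k, k + 1, by omega, by omega, h3, h4⟩

theorem exists_path {V : Type*} (Adj : V → V → Prop) {u v : V}
    (h : Relation.ReflTransGen Adj u v) :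
    ∃ x : List V, x.IsChain Adj ∧ x.head? = some u ∧ x.getLast? = some v := by
  induction h with
  | refl => exact ⟨[u], by simp⟩
  | tail _ hbc ih =>
    rename_i b c _
    obtain ⟨x, hx, h1, h2⟩ := ih
    refine ⟨x ++ [c], ?_, ?_, by simp⟩
    · rw [List.isChain_append]
      refine ⟨hx, by simp, ?_⟩
      intro p hp q hq
      simp_all
    · simp [List.head?_append, h1]

theorem exists_walk {V : Type*} (Adj : V → V → Prop)
    (hc : ∀ u v : V, Relation.ReflTransGen Adj u v) (L : List (V × V)) :
    (∀ p ∈ L, Adj p.1 p.2) → ∀ u v : V,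
    ∃ x : List V, x.IsChain Adj ∧ x.head? = some u ∧ x.getLast? = some v ∧
      L.length ≤ x.length ∧ ∀ p ∈ L, seqArc 2 x p.1 p.2 := by
  induction L with
  | nil =>
    intro _ u v
    obtain ⟨x, h1, h2, h3⟩ := exists_path Adj (hc u v)
    exact ⟨x, h1, h2, h3, by simp, by simp⟩
  | cons p L ih =>
    intro hL u v
    obtain ⟨a, b⟩ := p
    have hab : Adj a b := hL (a, b) (by simp)
    obtain ⟨y, y1, y2, y3, y4, y5⟩ := ih (fun p hp => hL p (by simp [hp])) b v
    obtain ⟨x, x1, x2, x3⟩ := exists_path Adj (hc u a)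
    have hxl : 0 < x.length := by
      rcases x with _ | _ <;> simp_all
    refine ⟨x ++ y, ?_, ?_, ?_, ?_, ?_⟩
    · rw [List.isChain_append]
      refine ⟨x1, y1, ?_⟩
      intro p hp q hq
      simp_all
    · simp [List.head?_append, x2]
    · simp [List.getLast?_append, y3]
    · simp; omega
    · intro p hp
      rw [seqArc_two]
      rcases List.mem_cons.1 hp with rfl | hp
      · refine ⟨x.length - 1, ?_, ?_⟩
        · rw [List.getElem?_append_left (by omega), ← List.getLast?_eq_getElem?, x3]
        · rw [List.getElem?_append_right (by omega)]
          have : x.length - 1 + 1 - x.length = 0 := by omega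
          rw [this, ← List.head?_eq_getElem?, y2]
      · obtain ⟨k, h1, h2⟩ := (seqArc_two _ _ _).1 (y5 p hp)
        refine ⟨x.length + k, ?_, ?_⟩
        · rw [List.getElem?_append_right (by omega), ← h1]
          congr 1; omega
        · rw [List.getElem?_append_right (by omega), ← h2]
          congr 1; omega

theorem exists_adj {V : Type*} [Fintype V] (Adj : V → V → Prop)
    (hcard : 1 < Fintype.card V) (hc : ∀ u v : V, Relation.ReflTransGen Adj u v) (u : V) :
    ∃ v, Adj u v := by
  obtain ⟨w, hw⟩ := Fintype.exists_ne_of_one_lt_card hcard u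
  rcases Relation.ReflTransGen.cases_head (hc u w) with h | ⟨c, h, _⟩
  · exact absurd h.symm hw
  · exact ⟨c, h⟩

theorem exists_real {V : Type*} [Fintype V] (Adj : V → V → Prop) (hsymm : Symmetric Adj)
    (hcard : 1 < Fintype.card V) (hc : ∀ u v : V, Relation.ReflTransGen Adj u v)
    (u v : V) (n : ℕ) :
    ∃ x : List V, IsRealizationG 2 Adj x ∧ x.head? = some u ∧ x.getLast? = some v ∧
      n ≤ x.length := by
  classical
  obtain ⟨w, hw⟩ := exists_adj Adj hcard hc u
  obtain ⟨x, h1, h2, h3, h4, h5⟩ := exists_walk Adj hc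
    ((Finset.univ.filter (fun p : V × V => Adj p.1 p.2)).toList ++ List.replicate n (u, w))
    (by
      intro p hp
      rcases List.mem_append.1 hp with hp | hp
      · simpa using hp
      · rw [List.eq_of_mem_replicate hp]; exact hw) u v
  have h6 : ∀ a b, Adj a b → seqArc 2 x a b := fun a b hab =>
    h5 (a, b) (List.mem_append_left _ (by simpa using hab))
  have h7 : ∀ a b, seqArc 2 x a b → Adj a b := by
    intro a b hab
    obtain ⟨k, ha, hb⟩ := (seqArc_two _ _ _).1 hab
    obtain ⟨hk, rfl⟩ := List.getElem?_eq_some_iff.1 ha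
    obtain ⟨hk', rfl⟩ := List.getElem?_eq_some_iff.1 hb
    exact List.isChain_iff_getElem.1 h1 k hk'
  refine ⟨x, ⟨?_, ?_, ?_⟩, h2, h3, ?_⟩
  · rintro rfl; simp at h2
  · intro a
    obtain ⟨b, hab⟩ := exists_adj Adj hcard hc a
    obtain ⟨k, ha, _⟩ := (seqArc_two _ _ _).1 (h6 a b hab)
    exact List.mem_of_getElem? ha
  · intro a b
    refine ⟨fun h => Or.inl (h6 a b h), ?_⟩
    rintro (h | h)
    · exact h7 a b h
    · exact hsymm (h7 b a h)
  · rw [List.length_append, List.length_replicate] at h4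
    omega

theorem conn_of_real {V : Type*} (Adj : V → V → Prop) (hsymm : Symmetric Adj)
    (x : List V) (hx : IsRealizationG 2 Adj x) (u v : V) : Relation.ReflTransGen Adj u v := by
  obtain ⟨h0, h1, h2⟩ := hx
  have hl : 0 < x.length := List.length_pos_iff.2 h0
  have key : ∀ k (hk : k < x.length), Relation.ReflTransGen Adj x[0] x[k] := by
    intro k
    induction k with
    | zero => intro _; exact .refl
    | succ k ih =>
      intro hk
      refine (ih (by omega)).tail ((h2 _ _).2 (Or.inl ?_))
      rw [seqArc_two]
      exact ⟨k, by simp, by simp⟩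
  have key2 : ∀ a, Relation.ReflTransGen Adj x[0] a := by
    intro a
    obtain ⟨k, hk, rfl⟩ := List.getElem_of_mem (h1 a)
    exact key k hk
  have hs : Relation.ReflTransGen Adj u x[0] := by
    have := (key2 u).swap
    exact Relation.ReflTransGen.mono (fun a b h => hsymm h) _ _ this
  exact hs.trans (key2 v)

theorem stmt0 {V : Type*} [Fintype V] (Adj : V → V → Prop) (hsymm : Symmetric Adj)
    (hcard : 1 < Fintype.card V) :
    ((∀ u v : V, Relation.ReflTransGen Adj u v) ↔ ∃ x : List V, IsRealizationG 2 Adj x) ∧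
    ((∃ x : List V, IsRealizationG 2 Adj x) ↔ {x : List V | IsRealizationG 2 Adj x}.Infinite) ∧
    ((∀ u v : V, Relation.ReflTransGen Adj u v) →
      ∀ u v : V, ∃ x : List V, IsRealizationG 2 Adj x ∧
        x.head? = some u ∧ x.getLast? = some v) := by
  have h21 : (∃ x : List V, IsRealizationG 2 Adj x) →
      ∀ u v : V, Relation.ReflTransGen Adj u v :=
    fun ⟨x, hx⟩ u v => conn_of_real Adj hsymm x hx u v
  obtain ⟨a⟩ : Nonempty V := Fintype.card_pos_iff.1 (by omega)
  refine ⟨⟨fun hc => ?_, h21⟩, ⟨fun h => ?_, fun h => h.nonempty⟩, fun hc u v => ?_⟩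
  · obtain ⟨x, hx, _⟩ := exists_real Adj hsymm hcard hc a a 0
    exact ⟨x, hx⟩
  · apply Set.Infinite.of_image List.length
    apply Set.infinite_of_forall_exists_gt
    intro n
    obtain ⟨x, hx, _, _, hn⟩ := exists_real Adj hsymm hcard (h21 h) a a (n + 1)
    exact ⟨x.length, ⟨x, hx, rfl⟩, by omega⟩
  · obtain ⟨x, hx, h1, h2, _⟩ := exists_real Adj hsymm hcard hc u v 0
    exact ⟨x, hx, h1, h2⟩
end

section
/- Let w ≥ 3, and let G = (V,A) be a directed graph with no self-loops, with n = |V|, having a source vertex s (a vertex of in-degree 0). Construct the digraph G' with vertex set V' = {x_p^i : p ∈ [2n+1], i ∈ [w−2]} ∪ {v_0, v_1 : v ∈ V}, compulsory arc set A'_c = {(v_0, v_1) : v ∈ V}, and optional arcs: (u_1, v_0) for each (u,v) ∈ A; the arcs (x^i_{2p−1}, v_0), (v_0, x^i_{2p}), (x^i_{2p}, v_1), (v_1, x^i_{2p+1}) for each v ∈ V, p ∈ [n], i ∈ [w−2]; the arcs (x^i_p, x^j_p) for i < j and p ∈ [2n+1]; and the arcs (x^i_p, x^j_{p+1}) for j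 ≤ i and p ∈ [2n]. Let P be the starting sequence (x_1^1, …, x_1^{w−2}, s_0). Then there exists a finite sequence S over V' starting with P such that the sequence digraph of S with window size w contains every compulsory arc of A'_c and contains only arcs belonging to A'_c or to the optional arcs, if and only if G admits a Hamiltonian path (a directed path visiting every vertex of G exactly once). -/
/-- Vertex set `V'` of the digraph `G'` of the reduction: the grid vertices `x_p^i`
(`p ∈ [2n+1]`, `i ∈ [w−2]`, encoded 0-based as `Sum.inl (p−1, i−1)`) together with the
vertices `v_0 = Sum.inr (v, false)` and `v_1 = Sum.inr (v, true)` for `v ∈ V`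
(here `n = |V|`). -/
abbrev RedV (V : Type*) [Fintype V] (w : ℕ) : Type _ :=
  (Fin (2 * Fintype.card V + 1) × Fin (w - 2)) ⊕ (V × Bool)

/-- Compulsory arcs of `G'`: the arcs `(v_0, v_1)` for `v ∈ V`. -/
def CompArc {V : Type*} [Fintype V] (w : ℕ) (a b : RedV V w) : Prop :=
  ∃ v : V, a = Sum.inr (v, false) ∧ b = Sum.inr (v, true)

/-- Optional arcs of `G'` (indices of the grid rows are encoded 0-based, so the 1-based row
`2p−1` with `p ∈ [n]` becomes an even row `< 2n`, the row `2p` becomes an odd row, and the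
row `2p+1` becomes a positive even row). -/
def OptArc {V : Type*} [Fintype V] (Adj : V → V → Prop) (w : ℕ) (a b : RedV V w) : Prop :=
  -- (u_1, v_0) for each arc (u,v) of G
  (∃ u v : V, Adj u v ∧ a = Sum.inr (u, true) ∧ b = Sum.inr (v, false)) ∨
  -- (x^i_{2p−1}, v_0)
  (∃ (q : Fin (2 * Fintype.card V + 1)) (i : Fin (w - 2)) (v : V),
    Even q.val ∧ q.val < 2 * Fintype.card V ∧ a = Sum.inl (q, i) ∧ b = Sum.inr (v, false)) ∨
  -- (v_0, x^i_{2p})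
  (∃ (q : Fin (2 * Fintype.card V + 1)) (i : Fin (w - 2)) (v : V),
    Odd q.val ∧ a = Sum.inr (v, false) ∧ b = Sum.inl (q, i)) ∨
  -- (x^i_{2p}, v_1)
  (∃ (q : Fin (2 * Fintype.card V + 1)) (i : Fin (w - 2)) (v : V),
    Odd q.val ∧ a = Sum.inl (q, i) ∧ b = Sum.inr (v, true)) ∨
  -- (v_1, x^i_{2p+1})
  (∃ (q : Fin (2 * Fintype.card V + 1)) (i : Fin (w - 2)) (v : V),
    Even q.val ∧ 0 < q.val ∧ a = Sum.inr (v, true) ∧ b = Sum.inl (q, i)) ∨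
  -- (x^i_p, x^j_p) for i < j
  (∃ (q : Fin (2 * Fintype.card V + 1)) (i j : Fin (w - 2)),
    i < j ∧ a = Sum.inl (q, i) ∧ b = Sum.inl (q, j)) ∨
  -- (x^i_p, x^j_{p+1}) for j ≤ i
  (∃ (q q' : Fin (2 * Fintype.card V + 1)) (i j : Fin (w - 2)),
    q'.val = q.val + 1 ∧ j.val ≤ i.val ∧ a = Sum.inl (q, i) ∧ b = Sum.inl (q', j))

/-- The starting sequence `P = (x_1^1, …, x_1^{w−2}, s_0)`. -/
def startP {V : Type*} [Fintype V] (w : ℕ) (s : V) : List (RedV V w) :=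
  ((List.finRange (w - 2)).map fun i =>
    (Sum.inl ((⟨0, by omega⟩ : Fin (2 * Fintype.card V + 1)), i) : RedV V w)) ++
    [Sum.inr (s, false)]

def Legal17 {V : Type*} [Fintype V] (Adj : V → V → Prop) (w : ℕ) (a b : RedV V w) : Prop :=
  CompArc w a b ∨ OptArc Adj w a b

section aux
variable {V : Type*} [Fintype V] {Adj : V → V → Prop} {w : ℕ}

theorem legal_ll (p q : Fin (2 * Fintype.card V + 1)) (i j : Fin (w - 2)) :
    Legal17 Adj w (Sum.inl (p, i)) (Sum.inl (q, j)) ↔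
      (p.val = q.val ∧ i.val < j.val) ∨ (q.val = p.val + 1 ∧ j.val ≤ i.val) := by
  constructor
  · rintro (⟨v, h, -⟩ | ⟨u, v, -, h, -⟩ | ⟨_, _, _, -, -, -, h⟩ | ⟨_, _, _, -, h, -⟩ | ⟨_, _, _, -, -, h⟩ |
      ⟨_, _, _, -, -, h, -⟩ | ⟨_, _, _, h, h1, h2⟩ | ⟨_, _, _, _, h, h', h1, h2⟩)
    all_goals try cases h
    · cases h1; cases h2; left; exact ⟨rfl, h⟩
    · cases h1; cases h2; right; exact ⟨h, h'⟩
  · rintro (⟨h, h'⟩ | ⟨h, h'⟩)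
    · have := Fin.ext h
      subst this
      exact Or.inr (Or.inr (Or.inr (Or.inr (Or.inr (Or.inr (Or.inl ⟨p, i, j, h', rfl, rfl⟩))))))
    · exact Or.inr (Or.inr (Or.inr (Or.inr (Or.inr (Or.inr (Or.inr ⟨p, q, i, j, h, h', rfl, rfl⟩))))))

theorem legal_lr (p : Fin (2 * Fintype.card V + 1)) (i : Fin (w - 2)) (v : V) (b : Bool) :
    Legal17 Adj w (Sum.inl (p, i)) (Sum.inr (v, b)) ↔
      (b = false ∧ p.val % 2 = 0 ∧ p.val < 2 * Fintype.card V) ∨ (b = true ∧ p.val % 2 = 1) := by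
  constructor
  · rintro (⟨v, h, -⟩ | ⟨u, v, -, h, -⟩ | ⟨_, _, _, h1, h2, h3, h⟩ | ⟨_, _, _, -, h, -⟩ | ⟨_, _, _, h1, h2, h⟩ |
      ⟨_, _, _, -, -, h, -⟩ | ⟨_, _, _, -, -, h⟩ | ⟨_, _, _, _, -, -, -, h⟩)
    all_goals cases h
    · cases h3; left; exact ⟨rfl, Nat.even_iff.1 h1, h2⟩
    · cases h2; right; exact ⟨rfl, Nat.odd_iff.1 h1⟩
  · rintro (⟨rfl, h, h'⟩ | ⟨rfl, h⟩)
    · exact Or.inr (Or.inr (Or.inl ⟨p, i, v, Nat.even_iff.2 h, h', rfl, rfl⟩))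
    · exact Or.inr (Or.inr (Or.inr (Or.inr (Or.inl ⟨p, i, v, Nat.odd_iff.2 h, rfl, rfl⟩))))

theorem legal_rl (p : Fin (2 * Fintype.card V + 1)) (i : Fin (w - 2)) (v : V) (b : Bool) :
    Legal17 Adj w (Sum.inr (v, b)) (Sum.inl (p, i)) ↔
      (b = false ∧ p.val % 2 = 1) ∨ (b = true ∧ p.val % 2 = 0 ∧ 0 < p.val) := by
  constructor
  · rintro (⟨v, -, h⟩ | ⟨u, v, -, -, h⟩ | ⟨_, _, _, -, -, h, -⟩ | ⟨_, _, _, h1, h2, h⟩ | ⟨_, _, _, -, h, -⟩ |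
      ⟨_, _, _, h1, h2, h3, h⟩ | ⟨_, _, _, -, h, -⟩ | ⟨_, _, _, _, -, -, h, -⟩)
    all_goals cases h
    · cases h2; left; exact ⟨rfl, Nat.odd_iff.1 h1⟩
    · cases h3; right; exact ⟨rfl, Nat.even_iff.1 h1, h2⟩
  · rintro (⟨rfl, h⟩ | ⟨rfl, h, h'⟩)
    · exact Or.inr (Or.inr (Or.inr (Or.inl ⟨p, i, v, Nat.odd_iff.2 h, rfl, rfl⟩)))
    · exact Or.inr (Or.inr (Or.inr (Or.inr (Or.inr (Or.inl
        ⟨p, i, v, Nat.even_iff.2 h, h', rfl, rfl⟩)))))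

theorem legal_rr (v v' : V) (b b' : Bool) :
    Legal17 Adj w (Sum.inr (v, b)) (Sum.inr (v', b')) ↔
      (b = false ∧ b' = true ∧ v = v') ∨ (b = true ∧ b' = false ∧ Adj v v') := by
  constructor
  · rintro (⟨v, h1, h⟩ | ⟨u, v, h1, h2, h⟩ | ⟨_, _, _, -, -, h, -⟩ | ⟨_, _, _, -, -, h⟩ | ⟨_, _, _, -, h, -⟩ |
      ⟨_, _, _, -, -, -, h⟩ | ⟨_, _, _, -, h, -⟩ | ⟨_, _, _, _, -, -, h, -⟩)
    all_goals cases h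
    · cases h1; left; exact ⟨rfl, rfl, rfl⟩
    · cases h2; right; exact ⟨rfl, rfl, h1⟩
  · rintro (⟨rfl, rfl, rfl⟩ | ⟨rfl, rfl, h⟩)
    · exact Or.inl ⟨v, rfl, rfl⟩
    · exact Or.inr (Or.inl ⟨v, v', h, rfl, rfl⟩)

def Shape17 (w q r : ℕ) : RedV V w → Prop
  | Sum.inl (p, i) => p.val = q ∧ i.val = r ∧ r < w - 2
  | Sum.inr (_, b) => r = w - 2 ∧ (b = true ↔ q % 2 = 1)

set_option maxHeartbeats 4000000 in
theorem shape_all (hw : 3 ≤ w) (s : V) (S : List (RedV V w)) (hP : startP w s <+: S)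
    (hL : ∀ a b : RedV V w, seqArc w S a b → Legal17 Adj w a b) (q : ℕ) :
    ∀ r, r < w - 1 → ∀ a, S[q * (w - 1) + r]? = some a → Shape17 w q r a := by
  induction q with
  | zero =>
    intro r hr a ha
    rw [List.prefix_iff_getElem?] at hP
    have hlen : r < (startP w s).length := by simp [startP]; omega
    have := hP r hlen
    simp only [zero_mul, zero_add] at ha
    rw [ha] at this
    simp only [Option.some.injEq] at this
    subst this
    by_cases h : r < w - 2
    · simp [startP, List.getElem_append, h, Shape17]
    · simp [startP, List.getElem_append, h, Shape17]; omega
  | succ q ihq =>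
    intro r
    induction r with
    | zero => 
      intro hr a ha
      have e : (q + 1) * (w - 1) = q * (w - 1) + (w - 1) := by ring
      rw [e] at ha
      generalize q * (w - 1) = B at *
      have hlt : B + (w - 1) + 0 < S.length := (List.getElem?_eq_some_iff.1 ha).1
      have h1 : S[B + 0]? = some S[B + 0] := List.getElem?_eq_getElem (by omega)
      have h2 : S[B + (w - 2)]? = some S[B + (w - 2)] := List.getElem?_eq_getElem (by omega)
      have s1 := ihq 0 (by omega) _ h1
      have s2 := ihq (w - 2) (by omega) _ h2
      have l1 := hL _ _ ⟨_, _, by omega, by omega, h1, ha⟩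
      have l2 := hL _ _ ⟨_, _, by omega, by omega, h2, ha⟩
      generalize S[B + 0] = y1 at *
      generalize S[B + (w - 2)] = y2 at *
      rcases y1 with ⟨p1, i1⟩ | ⟨v1, b1⟩ <;> rcases y2 with ⟨p2, i2⟩ | ⟨v2, b2⟩ <;>
        rcases a with ⟨p, i⟩ | ⟨v, b⟩ <;>
        simp only [Shape17, legal_ll, legal_lr, legal_rl, legal_rr] at * <;>
        (try cases b) <;> (try cases b2) <;> simp at * <;> omega
    | succ r ihr =>
      intro hr a ha
      have ihr := ihr (by omega)
      have e : (q + 1) * (w - 1) = q * (w - 1) + (w - 1) := by ring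
      rw [e] at ha ihr
      generalize q * (w - 1) = B at *
      have hlt : B + (w - 1) + (r + 1) < S.length := (List.getElem?_eq_some_iff.1 ha).1
      have h1 : S[B + (r + 1)]? = some S[B + (r + 1)] := List.getElem?_eq_getElem (by omega)
      have h2 : S[B + (w - 2)]? = some S[B + (w - 2)] := List.getElem?_eq_getElem (by omega)
      have h3 : S[B + (w - 1) + r]? = some S[B + (w - 1) + r] :=
        List.getElem?_eq_getElem (by omega)
      have s1 := ihq (r + 1) (by omega) _ h1
      have s2 := ihq (w - 2) (by omega) _ h2
      have s3 := ihr _ h3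
      have l1 := hL _ _ ⟨_, _, by omega, by omega, h1, ha⟩
      have l2 := hL _ _ ⟨_, _, by omega, by omega, h2, ha⟩
      have l3 := hL _ _ ⟨_, _, by omega, by omega, h3, ha⟩
      generalize S[B + (r + 1)] = y1 at *
      generalize S[B + (w - 2)] = y2 at *
      generalize S[B + (w - 1) + r] = y3 at *
      clear h1 h2 h3 ha hL hP ihq ihr
      rcases y1 with ⟨p1, i1⟩ | ⟨v1, b1⟩ <;> rcases y2 with ⟨p2, i2⟩ | ⟨v2, b2⟩ <;>
        rcases y3 with ⟨p3, i3⟩ | ⟨v3, b3⟩ <;>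
        rcases a with ⟨p, i⟩ | ⟨v, b⟩ <;>
        simp only [Shape17, legal_ll, legal_lr, legal_rl, legal_rr] at * <;>
        (try cases b) <;> (try cases b2) <;> (try cases b1) <;> simp at * <;> omega

/-- the sequence built from a Hamiltonian path -/
def elt17 (L : ℕ → V) (w q r : ℕ) : RedV V w :=
  if h : q < 2 * Fintype.card V + 1 ∧ r < w - 2 then Sum.inl (⟨q, h.1⟩, ⟨r, h.2⟩)
  else Sum.inr (L (q / 2), decide (q % 2 = 1))

theorem elt_legal (L : ℕ → V) (hA : ∀ i, i + 1 < Fintype.card V → Adj (L i) (L (i + 1)))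
    (q r q' r' : ℕ) (hq : q < 2 * Fintype.card V) (hq' : q' < 2 * Fintype.card V)
    (hr : r < w - 1) (hr' : r' < w - 1)
    (h : (q' = q ∧ r < r') ∨ (q' = q + 1 ∧ r' ≤ r)) :
    Legal17 Adj w (elt17 L w q r) (elt17 L w q' r') := by
  unfold elt17
  split_ifs with h1 h2 h2
  · rw [legal_ll]; simp only; omega
  · rw [legal_lr]; simp only [decide_eq_false_iff_not, decide_eq_true_eq]; omega
  · rw [legal_rl]; simp only [decide_eq_false_iff_not, decide_eq_true_eq]; omega
  · rw [legal_rr]; simp only [decide_eq_false_iff_not, decide_eq_true_eq]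
    have : q' = q + 1 := by omega
    subst this
    rcases Nat.mod_two_eq_zero_or_one q with hm | hm
    · left; refine ⟨by omega, by omega, ?_⟩; congr 1; omega
    · right; refine ⟨by omega, by omega, ?_⟩
      have : (q + 1) / 2 = q / 2 + 1 := by omega
      rw [this]; exact hA _ (by omega)

end aux

theorem stmt17 {V : Type*} [Fintype V] (Adj : V → V → Prop)
    (hloopfree : ∀ v : V, ¬ Adj v v) (w : ℕ) (hw : 3 ≤ w)
    (s : V) (hsource : ∀ u : V, ¬ Adj u s) :
    (∃ S : List (RedV V w), startP w s <+: S ∧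
        (∀ a b : RedV V w, CompArc w a b → seqArc w S a b) ∧
        (∀ a b : RedV V w, seqArc w S a b → CompArc w a b ∨ OptArc Adj w a b)) ↔
    (∃ l : List V, l.Nodup ∧ (∀ v : V, v ∈ l) ∧ l.Chain' Adj) := by
  constructor
  · rintro ⟨S, hP, hC, hL⟩
    have hL : ∀ a b : RedV V w, seqArc w S a b → Legal17 Adj w a b := hL
    have hS := shape_all hw s S hP hL
    have key : ∀ v : V, ∃ i : Fin (Fintype.card V),
        S[(2 * i.val + 1) * (w - 1) + (w - 2)]? = some (Sum.inr (v, true)) := by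
      intro v
      obtain ⟨k, k', -, -, -, hk⟩ := hC _ _ ⟨v, rfl, rfl⟩
      have hdm : k' / (w - 1) * (w - 1) + k' % (w - 1) = k' := Nat.div_add_mod' _ _
      have hr : k' % (w - 1) < w - 1 := Nat.mod_lt _ (by omega)
      generalize k' / (w - 1) = q at *
      generalize k' % (w - 1) = r at *
      subst hdm
      have h1 := hS q r hr _ hk
      simp only [Shape17, true_iff] at h1
      obtain ⟨rfl, hq⟩ := h1
      have hlt := (List.getElem?_eq_some_iff.1 hk).1
      have h2 : S[q * (w - 1) + (w - 3)]? = some S[q * (w - 1) + (w - 3)] :=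
        List.getElem?_eq_getElem (by omega)
      have h3 := hS q (w - 3) (by omega) _ h2
      have hq2 : q < 2 * Fintype.card V + 1 := by
        generalize S[q * (w - 1) + (w - 3)] = y at *
        rcases y with ⟨p, i⟩ | ⟨v, b⟩
        · simp only [Shape17] at h3; omega
        · simp only [Shape17] at h3; omega
      refine ⟨⟨q / 2, by omega⟩, ?_⟩
      have : 2 * (q / 2) + 1 = q := by omega
      simp only [this]
      exact hk
    choose g hg using key
    have ginj : Function.Injective g := by
      intro u v huv
      have h1 := hg u
      rw [huv, hg v] at h1
      simp at h1
      exact h1.symm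
    have gbij : Function.Bijective g :=
      (Fintype.bijective_iff_injective_and_card g).2 ⟨ginj, by simp⟩
    let e := Equiv.ofBijective g gbij
    have he : ∀ i, S[(2 * i.val + 1) * (w - 1) + (w - 2)]? = some (Sum.inr (e.symm i, true)) := by
      intro i
      have := hg (e.symm i)
      have h2 : g (e.symm i) = i := e.apply_symm_apply i
      rwa [h2] at this
    refine ⟨List.ofFn e.symm, List.nodup_ofFn.2 e.symm.injective, ?_, ?_⟩
    · intro v
      rw [List.mem_ofFn]
      exact ⟨e v, e.symm_apply_apply v⟩
    · show List.IsChain Adj _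
      rw [List.isChain_iff_getElem]
      intro i hi
      simp only [List.length_ofFn] at hi
      simp only [List.getElem_ofFn]
      have h1 := he ⟨i, by omega⟩
      have h3 := he ⟨i + 1, by omega⟩
      have e2 : (2 * i + 1 + 1) * (w - 1) = (2 * i + 1) * (w - 1) + (w - 1) := by ring
      have e3 : (2 * (i + 1) + 1) * (w - 1) = (2 * i + 1) * (w - 1) + (w - 1) + (w - 1) := by ring
      simp only at h1 h3
      have h2' := hS (2 * i + 1 + 1) (w - 2) (by omega)
      rw [e3] at h3
      rw [e2] at h2'
      generalize (2 * i + 1) * (w - 1) = B at *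
      have hlt := (List.getElem?_eq_some_iff.1 h3).1
      have h2 : S[B + (w - 1) + (w - 2)]? = some S[B + (w - 1) + (w - 2)] :=
        List.getElem?_eq_getElem (by omega)
      have s2 := h2' _ h2
      have l1 := hL _ _ ⟨_, _, by omega, by omega, h1, h2⟩
      have l2 := hL _ _ ⟨_, _, by omega, by omega, h2, h3⟩
      generalize S[B + (w - 1) + (w - 2)] = y at *
      rcases y with ⟨p, j⟩ | ⟨v, b⟩
      · simp only [Shape17] at s2; omega
      · rw [legal_rr] at l1 l2
        simp at l1 l2
        obtain ⟨hb, hadj⟩ := l1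
        subst hb
        simp at l2
        rw [← l2]; exact hadj
  · rintro ⟨l, hnd, hmem, hch⟩
    have hch : List.IsChain Adj l := hch
    rw [List.isChain_iff_getElem] at hch
    have hlen : l.length = Fintype.card V := by
      classical
      rw [← List.toFinset_card_of_nodup hnd, ← Finset.card_univ]
      congr 1
      ext v; simp [hmem v]
    let L : ℕ → V := fun i => l.getD i s
    have hLi : ∀ i (h : i < l.length), L i = l[i] := fun i h => by simp [L, h]
    have hA : ∀ i, i + 1 < Fintype.card V → Adj (L i) (L (i + 1)) := by
      intro i hi
      rw [hLi i (by omega), hLi (i + 1) (by omega)]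
      exact hch i (by omega)
    have hL0 : L 0 = s := by
      obtain ⟨i, hi, his⟩ := List.getElem_of_mem (hmem s)
      rcases i with _ | i
      · rw [hLi 0 hi, his]
      · exact absurd (his ▸ hch i hi) (hsource _)
    have hn : 0 < Fintype.card V := Fintype.card_pos_iff.2 ⟨s⟩
    have hw1 : 0 < w - 1 := by omega
    let N := 2 * Fintype.card V * (w - 1)
    let S : List (RedV V w) :=
      (List.range N).map fun k => elt17 L w (k / (w - 1)) (k % (w - 1))
    have hSget : ∀ q r, q < 2 * Fintype.card V → r < w - 1 →
        S[q * (w - 1) + r]? = some (elt17 L w q r) := by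
      intro q r hq hr
      have h1 : q * (w - 1) + r < N := by
        have : (q + 1) * (w - 1) ≤ N := Nat.mul_le_mul_right _ hq
        have e : (q + 1) * (w - 1) = q * (w - 1) + (w - 1) := by ring
        omega
      have h2 : (q * (w - 1) + r) / (w - 1) = q := by
        rw [mul_comm, Nat.mul_add_div hw1, Nat.div_eq_of_lt hr, add_zero]
      have h3 : (q * (w - 1) + r) % (w - 1) = r := by
        rw [mul_comm, Nat.mul_add_mod, Nat.mod_eq_of_lt hr]
      simp only [S, List.getElem?_map, List.getElem?_range h1, Option.map_some, h2, h3]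
    have hSinv : ∀ k a, S[k]? = some a → ∃ q r, q < 2 * Fintype.card V ∧ r < w - 1 ∧
        k = q * (w - 1) + r ∧ a = elt17 L w q r := by
      intro k a hk
      have hlt := (List.getElem?_eq_some_iff.1 hk).1
      have hlt : k < N := by simpa [S] using hlt
      refine ⟨k / (w - 1), k % (w - 1), (Nat.div_lt_iff_lt_mul hw1).2 hlt, Nat.mod_lt _ hw1,
        (Nat.div_add_mod' _ _).symm, ?_⟩
      simp only [S, List.getElem?_map, List.getElem?_range hlt, Option.map_some,
        Option.some.injEq] at hk
      exact hk.symm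
    refine ⟨S, ?_, ?_, ?_⟩
    · rw [List.prefix_iff_getElem?]
      intro r hr
      have hr' : r < w - 1 := by simp [startP] at hr; omega
      have := hSget 0 r (by omega) hr'
      rw [zero_mul, zero_add] at this
      rw [this]
      by_cases h : r < w - 2
      · simp [startP, List.getElem_append, h, elt17]
      · simp [startP, List.getElem_append, h, elt17, hL0]
    · rintro a b ⟨v, rfl, rfl⟩
      obtain ⟨i, hi, hiv⟩ := List.getElem_of_mem (hmem v)
      rw [← hLi i hi] at hiv
      have h1 := hSget (2 * i) (w - 2) (by omega) (by omega)
      have h2 := hSget (2 * i + 1) (w - 2) (by omega) (by omega)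
      have d1 : 2 * i / 2 = i := by omega
      have d2 : (2 * i + 1) / 2 = i := by omega
      have d3 : (2 * i + 1) % 2 = 1 := by omega
      have e : (2 * i + 1) * (w - 1) = 2 * i * (w - 1) + (w - 1) := by ring
      simp only [elt17, lt_irrefl, and_false, dite_false, d1, d2, d3, hiv] at h1 h2
      refine ⟨2 * i * (w - 1) + (w - 2), _, ?_, ?_, ?_, h2⟩
      rotate_left 2
      · rw [h1]; simp
      · omega
      · omega
    · rintro a b ⟨k, k', hk, hk', ha, hb⟩
      obtain ⟨q, r, hq, hr, rfl, rfl⟩ := hSinv _ _ ha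
      obtain ⟨q', r', hq', hr', rfl, rfl⟩ := hSinv _ _ hb
      refine elt_legal L hA q r q' r' hq hq' hr hr' ?_
      rcases lt_trichotomy q' q with h | h | h
      · exfalso
        have : (q' + 1) * (w - 1) ≤ q * (w - 1) := Nat.mul_le_mul_right _ h
        have e : (q' + 1) * (w - 1) = q' * (w - 1) + (w - 1) := by ring
        omega
      · subst h; left; omega
      · right
        have e : (q + 1) * (w - 1) = q * (w - 1) + (w - 1) := by ring
        rcases Nat.lt_or_ge (q + 1) q' with h2 | h2
        · exfalso
          have : (q + 1 + 1) * (w - 1) ≤ q' * (w - 1) := Nat.mul_le_mul_right _ h2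
          have e' : (q + 1 + 1) * (w - 1) = q * (w - 1) + (w - 1) + (w - 1) := by ring
          omega
        · have : q' = q + 1 := by omega
          subst this
          omega
end
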